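/- arXiv:1611.08557 — 2 statements merged into one kernel-verified Lean document; each statement's English description precedes it below -/
import Mathlib

section
/- The combination iJ₀(y) + J₀'(y) = (i/2π) ∫₀^{2π} e^{i y sinθ}(1 + sinθ) dθ admits, for y ≥ 1, the improved stationary-phase decomposition iJ₀(y) + J₀'(y) = y^{−1/2} e^{+iy} β₊(y) + y^{−3/2} e^{−iy} β₋(y), where β± satisfy |β±^{(n)}(y)| ≲_n y^{−n} for all n ≥ 0, y ≥ 1. -/
noncomputable section

/-- The Bessel function of order zero, `J₀(y) = (1/2π) ∫₀^{2π} e^{i y sin θ} dθ`. -/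
noncomputable def J0 (y : ℝ) : ℂ :=
  (1 / (2 * Real.pi) : ℝ) *
    ∫ θ in (0:ℝ)..(2 * Real.pi), Complex.exp (Complex.I * (y:ℂ) * (Real.sin θ : ℂ))

open Set Filter Topology MeasureTheory
open scoped ContDiff

/-- Smooth functions on the positive half-line which behave on `[1, ∞)` like classical symbols
of order `m`: each derivative gains a power of decay. -/
def IsSymbol (m : ℝ) (f : ℝ → ℂ) : Prop :=
  ContDiffOn ℝ ∞ f (Ioi 0) ∧
    ∀ n : ℕ, ∃ C : ℝ, ∀ y : ℝ, 1 ≤ y → ‖iteratedDeriv n f y‖ ≤ C * y ^ (m - n)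

lemma eqOn_iteratedDerivWithin_of_hasDerivAt {F : ℕ → ℝ → ℂ}
    (hF : ∀ n, ∀ y > 0, HasDerivAt (F n) (F (n + 1) y) y) (n : ℕ) :
    EqOn (iteratedDerivWithin n (F 0) (Ioi 0)) (F n) (Ioi 0) := by
  induction n with
  | zero => intro y _; simp
  | succ n ih =>
    intro y hy
    rw [iteratedDerivWithin_succ, derivWithin_congr ih (ih hy)]
    exact (hF n y hy).hasDerivWithinAt.derivWithin (isOpen_Ioi.uniqueDiffWithinAt hy)

lemma IsSymbol.of_hasDerivAt {m : ℝ} {F : ℕ → ℝ → ℂ}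
    (hF : ∀ n, ∀ y > 0, HasDerivAt (F n) (F (n + 1) y) y)
    (hb : ∀ n : ℕ, ∃ C : ℝ, ∀ y : ℝ, 1 ≤ y → ‖F n y‖ ≤ C * y ^ (m - n)) :
    IsSymbol m (F 0) := by
  have key := eqOn_iteratedDerivWithin_of_hasDerivAt hF
  refine ⟨contDiffOn_of_differentiableOn_deriv fun n _ => ?_, fun n => ?_⟩
  · exact DifferentiableOn.congr
      (fun y hy => (hF n y hy).differentiableAt.differentiableWithinAt) (key n)
  · obtain ⟨C, hC⟩ := hb n
    refine ⟨C, fun y hy => ?_⟩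
    have hy0 : y ∈ Ioi (0 : ℝ) := zero_lt_one.trans_le hy
    rw [← iteratedDerivWithin_of_isOpen isOpen_Ioi hy0, key n hy0]
    exact hC y hy

lemma isSymbol_const (c : ℂ) : IsSymbol 0 (fun _ => c) := by
  refine IsSymbol.of_hasDerivAt (F := fun n _ => if n = 0 then c else 0) (fun n y _ => ?_)
    fun n => ⟨‖c‖, fun y hy => ?_⟩
  · simpa using hasDerivAt_const y (if n = 0 then c else 0)
  · rcases n with _ | n
    · simp
    · have : 0 < y := zero_lt_one.trans_le hy
      simp only [Nat.add_eq_zero_iff, one_ne_zero, and_false, if_false, norm_zero]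
      positivity

lemma isSymbol_rpow (m : ℝ) : IsSymbol m (fun y => ((y ^ m : ℝ) : ℂ)) := by
  let c : ℕ → ℝ := fun n => ∏ k ∈ Finset.range n, (m - k)
  have h := IsSymbol.of_hasDerivAt (m := m) (F := fun n y => ((c n * y ^ (m - n) : ℝ) : ℂ))
    (fun n y hy => ?_) (fun n => ⟨|c n|, fun y hy => ?_⟩)
  · simpa [c] using h
  · refine HasDerivAt.ofReal_comp ?_
    have := (Real.hasDerivAt_rpow_const (p := m - n) (Or.inl hy.ne')).const_mul (c n)
    refine this.congr_deriv ?_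
    simp only [c, Finset.prod_range_succ]
    push_cast
    rw [sub_sub]
    ring
  · have : 0 < y := zero_lt_one.trans_le hy
    rw [Complex.norm_real, norm_mul, Real.norm_eq_abs, Real.norm_eq_abs,
      abs_of_pos (Real.rpow_pos_of_pos this _)]

lemma IsSymbol.mono {m m' : ℝ} {f : ℝ → ℂ} (hf : IsSymbol m f) (h : m ≤ m') :
    IsSymbol m' f := by
  refine ⟨hf.1, fun n => ?_⟩
  obtain ⟨C, hC⟩ := hf.2 n
  refine ⟨|C|, fun y hy => (hC y hy).trans ?_⟩
  have : 0 < y := zero_lt_one.trans_le hy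
  exact mul_le_mul (le_abs_self C) (Real.rpow_le_rpow_of_exponent_le hy (by linarith))
    (by positivity) (abs_nonneg C)

lemma IsSymbol.add {m : ℝ} {f g : ℝ → ℂ} (hf : IsSymbol m f) (hg : IsSymbol m g) :
    IsSymbol m (f + g) := by
  refine ⟨hf.1.add hg.1, fun n => ?_⟩
  obtain ⟨C, hC⟩ := hf.2 n
  obtain ⟨D, hD⟩ := hg.2 n
  refine ⟨C + D, fun y hy => ?_⟩
  have hy0 : Ioi (0 : ℝ) ∈ 𝓝 y := Ioi_mem_nhds (zero_lt_one.trans_le hy)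
  rw [iteratedDeriv_add ((hf.1.contDiffAt hy0).of_le (by exact_mod_cast le_top))
    ((hg.1.contDiffAt hy0).of_le (by exact_mod_cast le_top)), add_mul]
  exact (norm_add_le _ _).trans (add_le_add (hC y hy) (hD y hy))

lemma IsSymbol.mul {m k : ℝ} {f g : ℝ → ℂ} (hf : IsSymbol m f) (hg : IsSymbol k g) :
    IsSymbol (m + k) (fun y => f y * g y) := by
  refine ⟨hf.1.mul hg.1, fun n => ?_⟩
  choose C hC using hf.2
  choose D hD using hg.2
  refine ⟨∑ i ∈ Finset.range (n + 1), n.choose i * |C i| * |D (n - i)|, fun y hy => ?_⟩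
  have hy0 : y ∈ Ioi (0 : ℝ) := zero_lt_one.trans_le hy
  have hyp : 0 < y := hy0
  have h := norm_iteratedFDerivWithin_mul_le hf.1 hg.1 isOpen_Ioi.uniqueDiffOn hy0 (n := n)
    (by exact_mod_cast le_top)
  simp only [norm_iteratedFDerivWithin_eq_norm_iteratedDerivWithin] at h
  simp only [iteratedDerivWithin_of_isOpen isOpen_Ioi hy0] at h
  refine h.trans ?_
  rw [Finset.sum_mul]
  refine Finset.sum_le_sum fun i hi => ?_
  have hi' : i ≤ n := Nat.lt_succ_iff.mp (Finset.mem_range.mp hi)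
  have e : y ^ (m + k - n) = y ^ (m - i) * y ^ (k - (n - i : ℕ)) := by
    rw [← Real.rpow_add hyp, Nat.cast_sub hi']
    congr 1
    ring
  have h1 : ‖iteratedDeriv i f y‖ ≤ |C i| * y ^ (m - i) :=
    (hC i y hy).trans (by gcongr; exact le_abs_self _)
  have h2 : ‖iteratedDeriv (n - i) g y‖ ≤ |D (n - i)| * y ^ (k - (n - i : ℕ)) :=
    (hD _ y hy).trans (by gcongr; exact le_abs_self _)
  calc _ ≤ n.choose i * (|C i| * y ^ (m - i)) * (|D (n - i)| * y ^ (k - (n - i : ℕ))) := by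
        gcongr
    _ = _ := by rw [e]; ring

/-- A symbol of order zero agrees on `[1, ∞)` with a globally smooth function. -/
lemma IsSymbol.exists_contDiff {f : ℝ → ℂ} (hf : IsSymbol 0 f) :
    ∃ β : ℝ → ℂ, ContDiff ℝ ∞ β ∧
      (∀ n : ℕ, ∃ C > (0 : ℝ), ∀ y : ℝ, 1 ≤ y → ‖iteratedDeriv n β y‖ ≤ C * y ^ (-(n : ℝ))) ∧
      ∀ y : ℝ, 1 ≤ y → β y = f y := by
  let χ : ℝ → ℝ := fun y => Real.smoothTransition (4 * y - 1)
  have hχ : ContDiff ℝ ∞ χ :=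
    Real.smoothTransition.contDiff.comp ((contDiff_const.mul contDiff_id).sub contDiff_const)
  have hχ1 : ∀ y, 1 / 2 < y → χ y = 1 := fun y hy =>
    Real.smoothTransition.one_of_one_le (by linarith)
  have heq : ∀ y, 1 / 2 < y → (χ y : ℂ) * f y = f y := fun y hy => by rw [hχ1 y hy]; simp
  refine ⟨fun y => (χ y : ℂ) * f y, ?_, fun n => ?_, fun y hy => heq y (by linarith)⟩
  · rw [contDiff_iff_contDiffAt]
    intro y
    rcases lt_or_ge 0 y with hy | hy
    · exact (Complex.ofRealCLM.contDiff.comp hχ).contDiffAt.mul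
        (hf.1.contDiffAt (Ioi_mem_nhds hy))
    · refine contDiffAt_const (c := (0 : ℂ)) |>.congr_of_eventuallyEq ?_
      filter_upwards [Iio_mem_nhds (show y < 1 / 4 by linarith)] with z hz
      have hz' : z < 1 / 4 := hz
      have : χ z = 0 := Real.smoothTransition.zero_of_nonpos (by linarith)
      simp [this]
  · obtain ⟨C, hC⟩ := hf.2 n
    refine ⟨|C| + 1, by positivity, fun y hy => ?_⟩
    have hyp : 0 < y := zero_lt_one.trans_le hy
    have : (fun y => (χ y : ℂ) * f y) =ᶠ[𝓝 y] f := by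
      filter_upwards [Ioi_mem_nhds (show 1 / 2 < y by linarith)] with z hz using heq z hz
    rw [this.iteratedDeriv_eq n]
    refine (hC y hy).trans ?_
    rw [zero_sub]
    gcongr
    linarith [le_abs_self C]

/-- The amplitude `1 + σ i u / 2`, which for `σ = ±1` arises in the Laplace integral
representations of the two Hankel functions of order zero. -/
def hankelAmp (σ u : ℝ) : ℂ := 1 + σ * Complex.I * u / 2

lemma hankelAmp_re (σ u : ℝ) : (hankelAmp σ u).re = 1 := by
  simp [hankelAmp]

lemma hankelAmp_mem_slitPlane (σ u : ℝ) : hankelAmp σ u ∈ Complex.slitPlane := by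
  left; rw [hankelAmp_re]; exact one_pos

lemma hankelAmp_ne_zero (σ u : ℝ) : hankelAmp σ u ≠ 0 :=
  Complex.slitPlane_ne_zero (hankelAmp_mem_slitPlane σ u)

lemma one_le_norm_hankelAmp (σ u : ℝ) : 1 ≤ ‖hankelAmp σ u‖ := by
  simpa [hankelAmp_re] using Complex.re_le_norm (hankelAmp σ u)

lemma continuous_hankelAmp (σ : ℝ) : Continuous (hankelAmp σ) := by
  unfold hankelAmp; fun_prop

lemma continuous_hankelAmp_cpow (σ : ℝ) (c : ℂ) : Continuous fun u => hankelAmp σ u ^ c :=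
  (continuous_hankelAmp σ).cpow continuous_const (hankelAmp_mem_slitPlane σ)

lemma norm_hankelAmp_cpow_le_one (σ u : ℝ) : ‖hankelAmp σ u ^ (-(1 / 2) : ℂ)‖ ≤ 1 := by
  rw [Complex.norm_cpow_of_ne_zero (hankelAmp_ne_zero σ u)]
  simpa using Real.rpow_le_one_of_one_le_of_nonpos (one_le_norm_hankelAmp σ u)
    (by norm_num : (-2⁻¹ : ℝ) ≤ 0)

lemma norm_hankelAmp_cpow_sub_one_le {σ u : ℝ} (hσ : σ ^ 2 = 1) (hu : 0 ≤ u) :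
    ‖hankelAmp σ u ^ (-(1 / 2) : ℂ) - 1‖ ≤ u / 2 := by
  set z := hankelAmp σ u with hz
  have hz0 : z ≠ 0 := hankelAmp_ne_zero σ u
  set r := z ^ (-(1 / 2) : ℂ) with hr
  have hrr : r * r * z = 1 := by
    rw [hr, ← Complex.cpow_add _ _ hz0, show (-(1 / 2) + -(1 / 2) : ℂ) = -1 by norm_num,
      Complex.cpow_neg_one, inv_mul_cancel₀ hz0]
  have hre : 0 ≤ r.re := by
    rw [hr, Complex.cpow_def_of_ne_zero hz0, Complex.exp_re]
    refine mul_nonneg (Real.exp_pos _).le (Real.cos_nonneg_of_mem_Icc ?_)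
    have him : (Complex.log z * (-(1 / 2) : ℂ)).im = -(z.arg / 2) := by
      rw [show (-(1 / 2) : ℂ) = ((-(1 / 2) : ℝ) : ℂ) by push_cast; rfl, Complex.im_mul_ofReal,
        Complex.log_im]
      ring
    rw [him]
    constructor <;> linarith [Complex.neg_pi_lt_arg z, Complex.arg_le_pi z]
  have h1 : 1 ≤ ‖1 + r‖ := by
    have := Complex.re_le_norm (1 + r)
    simp only [Complex.add_re, Complex.one_re] at this
    linarith
  have hz1 : ‖1 - z‖ = u / 2 := by
    rw [hz, hankelAmp, show (1 : ℂ) - (1 + σ * Complex.I * u / 2) =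
      ((-(σ * u / 2) : ℝ) : ℂ) * Complex.I by push_cast; ring, norm_mul, Complex.norm_I,
      mul_one, Complex.norm_real, Real.norm_eq_abs, abs_neg]
    have : |σ| = 1 := by rw [← sq_eq_sq₀ (abs_nonneg _) zero_le_one, sq_abs, hσ]; norm_num
    rw [abs_div, abs_mul, this, abs_of_nonneg hu]
    norm_num
  have hr1 : ‖r‖ ≤ 1 := norm_hankelAmp_cpow_le_one σ u
  have hfac : (r - 1) * (1 + r) = r * r * (1 - z) := by linear_combination hrr
  calc ‖r - 1‖ ≤ ‖r - 1‖ * ‖1 + r‖ := le_mul_of_one_le_right (norm_nonneg _) h1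
    _ = ‖r‖ * ‖r‖ * ‖1 - z‖ := by rw [← norm_mul, hfac, norm_mul, norm_mul]
    _ ≤ 1 * 1 * (u / 2) := by rw [hz1]; gcongr
    _ = u / 2 := by ring

/-- The integrand of `hankelMoment`. -/
def hankelKernel (σ : ℝ) (n : ℕ) (y u : ℝ) : ℂ :=
  (-(u : ℂ)) ^ n * ((u ^ (-(1 / 2) : ℝ) * Real.exp (-(y * u)) : ℝ) : ℂ) *
    hankelAmp σ u ^ (-(1 / 2) : ℂ)

/-- The `n`-th derivative of the Laplace integral `∫₀^∞ e^{-yu} u^{-1/2} (1 + σiu/2)^{-1/2} du`.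
For `σ = ±1`, multiplying that integral by `e^{σiy}` gives a solution of Bessel's equation. -/
def hankelMoment (σ : ℝ) (n : ℕ) (y : ℝ) : ℂ := ∫ u in Ioi (0 : ℝ), hankelKernel σ n y u

lemma norm_hankelKernel_le (σ : ℝ) (n : ℕ) (y : ℝ) {u : ℝ} (hu : 0 < u) :
    ‖hankelKernel σ n y u‖ ≤ u ^ ((n + 1 / 2 : ℝ) - 1) * Real.exp (-(y * u)) := by
  have e : (u : ℝ) ^ ((n + 1 / 2 : ℝ) - 1) = u ^ n * u ^ (-(1 / 2) : ℝ) := by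
    rw [← Real.rpow_natCast, ← Real.rpow_add hu]; congr 1; ring
  have hpos : 0 < u ^ (-(1 / 2) : ℝ) * Real.exp (-(y * u)) := by positivity
  rw [hankelKernel, norm_mul, norm_mul, norm_pow, norm_neg, Complex.norm_real, Complex.norm_real,
    Real.norm_of_nonneg hu.le, Real.norm_of_nonneg hpos.le, e,
    mul_assoc (u ^ n) _ (Real.exp _)]
  exact mul_le_of_le_one_right (by positivity) (norm_hankelAmp_cpow_le_one σ u)

lemma aestronglyMeasurable_hankelKernel (σ : ℝ) (n : ℕ) (y : ℝ) :
    AEStronglyMeasurable (hankelKernel σ n y) (volume.restrict (Ioi 0)) := by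
  refine ContinuousOn.aestronglyMeasurable ?_ measurableSet_Ioi
  refine ContinuousOn.mul (ContinuousOn.mul (by fun_prop) ?_)
    (continuous_hankelAmp_cpow σ _).continuousOn
  refine Complex.continuous_ofReal.comp_continuousOn (ContinuousOn.mul ?_ (by fun_prop))
  exact fun u hu => (Real.continuousAt_rpow_const u _ (Or.inl (ne_of_gt hu))).continuousWithinAt

lemma integrableOn_rpow_mul_exp {a y : ℝ} (ha : 0 < a) (hy : 0 < y) :
    IntegrableOn (fun u => u ^ (a - 1) * Real.exp (-(y * u))) (Ioi 0) := by
  have := integrableOn_rpow_mul_exp_neg_mul_rpow (p := 1) (s := a - 1) (b := y)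
    (by linarith) one_pos hy
  simpa using this

lemma integrableOn_hankelKernel (σ : ℝ) (n : ℕ) {y : ℝ} (hy : 0 < y) :
    IntegrableOn (hankelKernel σ n y) (Ioi 0) := by
  refine Integrable.mono' (integrableOn_rpow_mul_exp (a := n + 1 / 2) (by positivity) hy)
    (aestronglyMeasurable_hankelKernel σ n y) ?_
  exact (ae_restrict_iff' measurableSet_Ioi).mpr
    (.of_forall fun u hu => norm_hankelKernel_le σ n y hu)

lemma norm_hankelMoment_le (σ : ℝ) (n : ℕ) {y : ℝ} (hy : 0 < y) :
    ‖hankelMoment σ n y‖ ≤ Real.Gamma (n + 1 / 2) * y ^ (-(1 / 2) - n : ℝ) := by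
  refine (norm_integral_le_of_norm_le
    (integrableOn_rpow_mul_exp (a := n + 1 / 2) (by positivity) hy)
    ((ae_restrict_iff' measurableSet_Ioi).mpr
      (.of_forall fun u hu => norm_hankelKernel_le σ n y hu))).trans_eq ?_
  rw [Real.integral_rpow_mul_exp_neg_mul_Ioi (by positivity) hy, mul_comm, one_div y,
    Real.inv_rpow hy.le, ← Real.rpow_neg hy.le]
  congr 2
  ring

lemma hasDerivAt_hankelMoment (σ : ℝ) (n : ℕ) {y : ℝ} (hy : 0 < y) :
    HasDerivAt (hankelMoment σ n) (hankelMoment σ (n + 1) y) y := by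
  refine (hasDerivAt_integral_of_dominated_loc_of_deriv_le (F := hankelKernel σ n)
    (F' := hankelKernel σ (n + 1)) (s := Ioi (y / 2))
    (bound := fun u => u ^ (((n + 1 : ℕ) + 1 / 2 : ℝ) - 1) * Real.exp (-(y / 2 * u)))
    (Ioi_mem_nhds (by linarith)) ?_ (integrableOn_hankelKernel σ n hy)
    (aestronglyMeasurable_hankelKernel σ (n + 1) y) ?_
    (integrableOn_rpow_mul_exp (by positivity) (by positivity)) ?_).2
  · exact .of_forall fun z => aestronglyMeasurable_hankelKernel σ n z
  · refine (ae_restrict_iff' measurableSet_Ioi).mpr (.of_forall fun u hu z hz => ?_)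
    have hu' : 0 < u := hu
    have hz' : y / 2 < z := hz
    exact (norm_hankelKernel_le σ (n + 1) z hu).trans (by gcongr)
  · refine .of_forall fun u z _ => ?_
    have h : HasDerivAt (fun z : ℝ => u ^ (-(1 / 2) : ℝ) * Real.exp (-(z * u)))
        (u ^ (-(1 / 2) : ℝ) * (Real.exp (-(z * u)) * -(1 * u))) z :=
      (((hasDerivAt_id z).mul_const u).neg.exp).const_mul _
    refine ((h.ofReal_comp.const_mul ((-(u : ℂ)) ^ n)).mul_const
      (hankelAmp σ u ^ (-(1 / 2) : ℂ))).congr_deriv ?_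
    rw [hankelKernel]
    push_cast
    ring

/-- The equation satisfied by the Laplace integral, equivalent to Bessel's equation. -/
lemma bessel_equation_hankelMoment {σ : ℝ} (hσ : σ ^ 2 = 1) {y : ℝ} (hy : 0 < y) :
    y * (hankelMoment σ 2 y + 2 * σ * Complex.I * hankelMoment σ 1 y) + hankelMoment σ 1 y +
      σ * Complex.I * hankelMoment σ 0 y = 0 := by
  have hσI : (σ * Complex.I) ^ 2 = -1 := by
    rw [mul_pow, Complex.I_sq, show (σ : ℂ) ^ 2 = 1 by exact_mod_cast hσ, one_mul]
  let f : ℝ → ℂ := fun u => -2 * σ * Complex.I *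
    (((u ^ (1 / 2 : ℝ) * Real.exp (-(y * u)) : ℝ) : ℂ) * hankelAmp σ u ^ (1 / 2 : ℂ))
  have hK := fun n => integrableOn_hankelKernel σ n hy
  have hamp : ∀ u, hankelAmp σ u ^ (1 / 2 : ℂ) =
      hankelAmp σ u ^ (-(1 / 2) : ℂ) * hankelAmp σ u := fun u => by
    have := Complex.cpow_add (-(1 / 2)) 1 (hankelAmp_ne_zero σ u)
    rwa [Complex.cpow_one, show (-(1 / 2) + 1 : ℂ) = 1 / 2 by norm_num] at this
  have hpow : ∀ u : ℝ, 0 < u → u ^ (1 / 2 : ℝ) = u * u ^ (-(1 / 2) : ℝ) := fun u hu => by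
    rw [show (1 / 2 : ℝ) = 1 + -(1 / 2) by norm_num, Real.rpow_add hu, Real.rpow_one]
    norm_num
  have hf : ∀ u ∈ Ioi (0 : ℝ), f u =
      hankelKernel σ 2 y u + 2 * σ * Complex.I * hankelKernel σ 1 y u := by
    intro u hu
    simp only [f, hankelKernel, hamp, hpow u hu]
    rw [hankelAmp]
    push_cast
    linear_combination (-(u : ℂ) ^ 2 * ((u ^ (-(1 / 2) : ℝ) : ℝ) : ℂ) *
      Complex.exp (-(y * u)) * (1 + σ * Complex.I * u / 2) ^ (-(1 / 2) : ℂ)) *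
      hσI
  have hf_int : IntegrableOn f (Ioi 0) :=
    (integrableOn_congr_fun hf measurableSet_Ioi).mpr ((hK 2).add ((hK 1).const_mul _))
  let f' : ℝ → ℂ := fun u => -(y * (hankelKernel σ 2 y u +
    2 * σ * Complex.I * hankelKernel σ 1 y u) + hankelKernel σ 1 y u +
      σ * Complex.I * hankelKernel σ 0 y u)
  have hf'_int : IntegrableOn f' (Ioi 0) :=
    (((((hK 2).add ((hK 1).const_mul _)).const_mul _).add (hK 1)).add ((hK 0).const_mul _)).neg
  have hd : ∀ u ∈ Ioi (0 : ℝ), HasDerivAt f (f' u) u := by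
    intro u hu
    have hu0 : 0 < u := hu
    have h1 : HasDerivAt (fun u : ℝ => u ^ (1 / 2 : ℝ) * Real.exp (-(y * u)))
        ((1 / 2) * u ^ (1 / 2 - 1 : ℝ) * Real.exp (-(y * u)) +
          u ^ (1 / 2 : ℝ) * (Real.exp (-(y * u)) * -(y * 1))) u :=
      (Real.hasDerivAt_rpow_const (Or.inl hu0.ne')).mul
        (((hasDerivAt_id u).const_mul y).neg.exp)
    have h2 : HasDerivAt (hankelAmp σ) (σ * Complex.I / 2) u := by
      have := (((hasDerivAt_id u).ofReal_comp.const_mul (σ * Complex.I)).div_const 2).const_add 1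
      exact this.congr_deriv (by simp)
    have h3 : HasDerivAt (fun u => hankelAmp σ u ^ (1 / 2 : ℂ))
        ((1 / 2 : ℂ) * hankelAmp σ u ^ (1 / 2 - 1 : ℂ) * (σ * Complex.I / 2)) u := by
      have := HasDerivAt.comp_of_eq u
        ((hasDerivAt_id (hankelAmp σ u)).cpow_const (c := (1 / 2 : ℂ))
          (hankelAmp_mem_slitPlane σ u)) h2 rfl
      exact this.congr_deriv (by simp)
    refine ((h1.ofReal_comp.mul h3).const_mul (-2 * σ * Complex.I)).congr_deriv ?_
    rw [show (1 / 2 - 1 : ℝ) = -(1 / 2) by norm_num, show (1 / 2 - 1 : ℂ) = -(1 / 2) by norm_num,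
      hamp, hpow u hu0]
    simp only [f', hankelKernel]
    set r := hankelAmp σ u ^ (-(1 / 2) : ℂ)
    rw [hankelAmp]
    push_cast
    linear_combination (((u ^ (-(1 / 2) : ℝ) : ℝ) : ℂ) * Complex.exp (-(y * u)) * r *
      (y * u ^ 2 - u)) * hσI
  have h0 : f 0 = 0 := by simp [f]
  have hcont : ContinuousWithinAt f (Ici 0) 0 := by
    refine Continuous.continuousWithinAt ?_
    refine continuous_const.mul (Continuous.mul (Complex.continuous_ofReal.comp ?_)
      (continuous_hankelAmp_cpow σ _))
    exact (Real.continuous_rpow_const (by norm_num)).mul (by fun_prop)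
  have h := integral_Ioi_of_hasDerivAt_of_tendsto hcont hd hf'_int
    (tendsto_zero_of_hasDerivAt_of_integrableOn_Ioi hd hf'_int hf_int)
  rw [h0, sub_zero] at h
  have e1 : IntegrableOn (fun u => hankelKernel σ 2 y u +
    2 * σ * Complex.I * hankelKernel σ 1 y u) (Ioi 0) := (hK 2).add ((hK 1).const_mul _)
  have e2 : IntegrableOn (fun u => y * (hankelKernel σ 2 y u +
    2 * σ * Complex.I * hankelKernel σ 1 y u) + hankelKernel σ 1 y u) (Ioi 0) :=
    (e1.const_mul _).add (hK 1)
  simp only [f'] at h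
  rw [integral_neg, integral_add e2 ((hK 0).const_mul _),
    integral_add (e1.const_mul _) (hK 1), integral_const_mul,
    integral_add (hK 2) ((hK 1).const_mul _), integral_const_mul, integral_const_mul,
    neg_eq_zero] at h
  exact h

lemma isSymbol_hankelMoment (σ : ℝ) (n : ℕ) :
    IsSymbol (-(1 / 2) - n) (hankelMoment σ n) := by
  have := IsSymbol.of_hasDerivAt (m := -(1 / 2) - n) (F := fun k => hankelMoment σ (n + k))
    (fun k y hy => hasDerivAt_hankelMoment σ (n + k) hy) 
    (fun k => ⟨Real.Gamma (((n + k : ℕ) : ℝ) + 1 / 2), fun y hy => ?_⟩)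
  · exact this
  · have := norm_hankelMoment_le σ (n + k) (zero_lt_one.trans_le hy)
    rwa [show (-(1 / 2) - (n + k : ℕ) : ℝ) = -(1 / 2) - n - k by push_cast; ring] at this

lemma norm_hankelMoment_one_le (σ : ℝ) : ‖hankelMoment σ 1 1‖ ≤ √Real.pi / 2 := by
  have := norm_hankelMoment_le σ 1 one_pos
  rw [Real.one_rpow, mul_one, Real.Gamma_nat_add_half] at this
  simpa using this

lemma le_norm_hankelMoment_zero {σ : ℝ} (hσ : σ ^ 2 = 1) :
    3 / 4 * √Real.pi ≤ ‖hankelMoment σ 0 1‖ := by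
  have hg : ∫ u in Ioi (0 : ℝ), (((u ^ ((1 / 2 : ℝ) - 1) * Real.exp (-(1 * u)) : ℝ)) : ℂ) =
      (√Real.pi : ℝ) := by
    rw [integral_complex_ofReal, Real.integral_rpow_mul_exp_neg_mul_Ioi (by norm_num) one_pos,
      Real.Gamma_one_half_eq]
    simp
  have hgi : IntegrableOn (fun u : ℝ => ((u ^ ((1 / 2 : ℝ) - 1) * Real.exp (-(1 * u)) : ℝ) : ℂ))
    (Ioi 0) := (integrableOn_rpow_mul_exp (by norm_num) one_pos).ofReal
  have hdiff : ‖hankelMoment σ 0 1 - (√Real.pi : ℝ)‖ ≤ √Real.pi / 4 := by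
    rw [← hg, hankelMoment, ← integral_sub (integrableOn_hankelKernel σ 0 one_pos) hgi]
    refine (norm_integral_le_of_norm_le
      ((integrableOn_rpow_mul_exp (a := (1 : ℕ) + 1 / 2) (y := 1)
        (by norm_num) one_pos).const_mul (1 / 2))
      ((ae_restrict_iff' measurableSet_Ioi).mpr (.of_forall fun u hu => ?_))).trans_eq ?_
    · have hu0 : 0 < u := hu
      have hpos : 0 < u ^ ((1 / 2 : ℝ) - 1) * Real.exp (-(1 * u)) := by positivity
      have e : hankelKernel σ 0 1 u - ((u ^ ((1 / 2 : ℝ) - 1) * Real.exp (-(1 * u)) : ℝ) : ℂ) =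
          ((u ^ ((1 / 2 : ℝ) - 1) * Real.exp (-(1 * u)) : ℝ) : ℂ) *
            (hankelAmp σ u ^ (-(1 / 2) : ℂ) - 1) := by
        rw [hankelKernel, show (1 / 2 - 1 : ℝ) = -(1 / 2) by norm_num]
        ring
      have e2 : u ^ (((1 : ℕ) + 1 / 2 : ℝ) - 1) = u ^ ((1 / 2 : ℝ) - 1) * u := by
        rw [← Real.rpow_add_one hu0.ne']; congr 1; norm_num
      rw [e, norm_mul, Complex.norm_real, Real.norm_of_nonneg hpos.le, e2]
      refine (mul_le_mul_of_nonneg_left (norm_hankelAmp_cpow_sub_one_le hσ hu0.le)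
        hpos.le).trans_eq ?_
      ring
    · rw [integral_const_mul, Real.integral_rpow_mul_exp_neg_mul_Ioi (by norm_num) one_pos,
        Real.Gamma_nat_add_half]
      simp
      ring
  have := norm_sub_norm_le ((√Real.pi : ℝ) : ℂ) (hankelMoment σ 0 1)
  rw [norm_sub_rev, Complex.norm_real, Real.norm_of_nonneg (Real.sqrt_nonneg _)] at this
  linarith

/-- The `n`-th derivative of `J0`, in integral form. -/
def J0Moment (n : ℕ) (y : ℝ) : ℂ :=
  (1 / (2 * Real.pi) : ℝ) * ∫ θ in (0:ℝ)..(2 * Real.pi),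
    (Complex.I * (Real.sin θ : ℂ)) ^ n * Complex.exp (Complex.I * (y:ℂ) * (Real.sin θ : ℂ))

lemma J0Moment_zero : J0Moment 0 = J0 := by
  funext y
  simp [J0Moment, J0]

lemma continuous_J0Moment_integrand (n : ℕ) (y : ℝ) : Continuous fun θ : ℝ =>
    (Complex.I * (Real.sin θ : ℂ)) ^ n * Complex.exp (Complex.I * (y:ℂ) * (Real.sin θ : ℂ)) := by
  fun_prop

lemma hasDerivAt_J0Moment (n : ℕ) (y : ℝ) : HasDerivAt (J0Moment n) (J0Moment (n + 1) y) y := by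
  refine HasDerivAt.const_mul _ ?_
  refine (intervalIntegral.hasDerivAt_integral_of_dominated_loc_of_deriv_le
    (F := fun (y : ℝ) (θ : ℝ) => (Complex.I * (Real.sin θ : ℂ)) ^ n *
      Complex.exp (Complex.I * (y:ℂ) * (Real.sin θ : ℂ)))
    (F' := fun (y : ℝ) (θ : ℝ) => (Complex.I * (Real.sin θ : ℂ)) ^ (n + 1) *
      Complex.exp (Complex.I * (y:ℂ) * (Real.sin θ : ℂ)))
    (bound := fun _ => 1) univ_mem ?_ ?_ ?_ ?_ ?_ ?_).2
  · exact .of_forall fun z => (continuous_J0Moment_integrand n z).aestronglyMeasurable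
  · exact (continuous_J0Moment_integrand n y).intervalIntegrable _ _
  · exact (continuous_J0Moment_integrand (n + 1) y).aestronglyMeasurable
  · refine .of_forall fun θ _ z _ => ?_
    have h : Complex.I * (z:ℂ) * (Real.sin θ : ℂ) = ((z * Real.sin θ : ℝ) : ℂ) * Complex.I := by
      push_cast; ring
    rw [h, norm_mul, Complex.norm_exp_ofReal_mul_I, norm_pow, norm_mul, Complex.norm_I, one_mul,
      mul_one, Complex.norm_real]
    exact pow_le_one₀ (norm_nonneg _) (Real.abs_sin_le_one θ)
  · exact intervalIntegrable_const
  · refine .of_forall fun θ _ z _ => ?_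
    have h : HasDerivAt (fun z : ℝ => Complex.I * (z:ℂ) * (Real.sin θ : ℂ))
        (Complex.I * (Real.sin θ : ℂ)) z := by
      simpa using ((hasDerivAt_id z).ofReal_comp.const_mul Complex.I).mul_const (Real.sin θ : ℂ)
    exact (h.cexp.const_mul ((Complex.I * (Real.sin θ : ℂ)) ^ n)).congr_deriv (by ring)

/-- Bessel's equation of order zero. -/
lemma bessel_equation_J0Moment (y : ℝ) :
    y * J0Moment 2 y + J0Moment 1 y + y * J0Moment 0 y = 0 := by
  have hi : ∀ n, IntervalIntegrable (fun θ : ℝ => (Complex.I * (Real.sin θ : ℂ)) ^ n *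
      Complex.exp (Complex.I * (y:ℂ) * (Real.sin θ : ℂ))) volume 0 (2 * Real.pi) := fun n =>
    (continuous_J0Moment_integrand n y).intervalIntegrable _ _
  have hd : ∀ θ : ℝ, HasDerivAt (fun θ : ℝ => -Complex.I * (Real.cos θ : ℂ) *
        Complex.exp (Complex.I * (y:ℂ) * (Real.sin θ : ℂ)))
      (y * ((Complex.I * (Real.sin θ : ℂ)) ^ 2 *
          Complex.exp (Complex.I * (y:ℂ) * (Real.sin θ : ℂ))) +
        (Complex.I * (Real.sin θ : ℂ)) ^ 1 *
          Complex.exp (Complex.I * (y:ℂ) * (Real.sin θ : ℂ)) +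
        y * ((Complex.I * (Real.sin θ : ℂ)) ^ 0 *
          Complex.exp (Complex.I * (y:ℂ) * (Real.sin θ : ℂ)))) θ := by
    intro θ
    have h1 := (Real.hasDerivAt_cos θ).ofReal_comp.const_mul (-Complex.I)
    have h2 := ((Real.hasDerivAt_sin θ).ofReal_comp.const_mul (Complex.I * (y:ℂ))).cexp
    refine (h1.mul h2).congr_deriv ?_
    have h3 : (Real.cos θ : ℂ) ^ 2 = 1 - (Real.sin θ : ℂ) ^ 2 := by
      rw [eq_sub_iff_add_eq]
      exact_mod_cast Real.cos_sq_add_sin_sq θ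
    push_cast at h3 ⊢
    linear_combination ((y:ℂ) * Complex.exp (Complex.I * (y:ℂ) * Complex.sin θ)) * h3 -
      (y:ℂ) * Complex.exp (Complex.I * (y:ℂ) * Complex.sin θ) *
        (Complex.cos θ ^ 2 + Complex.sin θ ^ 2) * Complex.I_sq
  have h := intervalIntegral.integral_eq_sub_of_hasDerivAt (a := 0) (b := 2 * Real.pi)
    (fun θ _ => hd θ) ((((hi 2).const_mul _).add (hi 1)).add ((hi 0).const_mul _))
  rw [intervalIntegral.integral_add (((hi 2).const_mul _).add (hi 1)) ((hi 0).const_mul _),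
    intervalIntegral.integral_add ((hi 2).const_mul _) (hi 1),
    intervalIntegral.integral_const_mul, intervalIntegral.integral_const_mul] at h
  simp only [Real.cos_two_pi, Real.sin_two_pi, Real.cos_zero, Real.sin_zero, sub_self] at h
  unfold J0Moment
  linear_combination ((1 / (2 * Real.pi) : ℝ) : ℂ) * h

lemma I_mul_J0_add_deriv (y : ℝ) : Complex.I * J0 y + deriv J0 y =
    (Complex.I / ((2 * Real.pi : ℝ) : ℂ)) * ∫ θ in (0:ℝ)..(2 * Real.pi),
      Complex.exp (Complex.I * (y:ℂ) * (Real.sin θ : ℂ)) * (1 + (Real.sin θ : ℂ)) := by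
  have hi := fun n => (continuous_J0Moment_integrand n y).intervalIntegrable (μ := volume)
    0 (2 * Real.pi)
  rw [← J0Moment_zero, (hasDerivAt_J0Moment 0 y).deriv]
  unfold J0Moment
  have hsplit : (fun θ : ℝ => Complex.exp (Complex.I * (y:ℂ) * (Real.sin θ : ℂ)) *
      (1 + (Real.sin θ : ℂ))) = fun θ : ℝ =>
      (Complex.I * (Real.sin θ : ℂ)) ^ 0 * Complex.exp (Complex.I * (y:ℂ) * (Real.sin θ : ℂ)) +
      -Complex.I * ((Complex.I * (Real.sin θ : ℂ)) ^ (0 + 1) *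
        Complex.exp (Complex.I * (y:ℂ) * (Real.sin θ : ℂ))) := by
    funext θ
    linear_combination (Real.sin θ : ℂ) * Complex.exp (Complex.I * (y:ℂ) * (Real.sin θ : ℂ)) *
      Complex.I_sq
  rw [hsplit, intervalIntegral.integral_add (hi 0) ((hi (0 + 1)).const_mul _),
    intervalIntegral.integral_const_mul]
  generalize (∫ θ in (0:ℝ)..(2 * Real.pi), (Complex.I * (Real.sin θ : ℂ)) ^ (0 + 1) *
    Complex.exp (Complex.I * (y:ℂ) * (Real.sin θ : ℂ))) = b
  push_cast
  linear_combination (1 / (2 * (Real.pi : ℂ))) * b * Complex.I_sq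

/-- `J₀` and its derivative are the same linear combination of the Hankel solutions and of their
derivatives. -/
lemma exists_J0_eq_hankel : ∃ p q : ℂ, ∀ y : ℝ, 0 < y →
    J0Moment 0 y = p * Complex.exp (Complex.I * y) * hankelMoment 1 0 y +
      q * Complex.exp (-(Complex.I * y)) * hankelMoment (-1) 0 y ∧
    J0Moment 1 y = p * Complex.exp (Complex.I * y) *
        (Complex.I * hankelMoment 1 0 y + hankelMoment 1 1 y) +
      q * Complex.exp (-(Complex.I * y)) *
        (-Complex.I * hankelMoment (-1) 0 y + hankelMoment (-1) 1 y) := by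
  -- the Hankel solutions and their first two derivatives
  let e : ℝ → ℝ → ℂ := fun σ y => Complex.exp (σ * Complex.I * y)
  let H0 : ℝ → ℝ → ℂ := fun σ y => e σ y * hankelMoment σ 0 y
  let H1 : ℝ → ℝ → ℂ := fun σ y =>
    e σ y * (σ * Complex.I * hankelMoment σ 0 y + hankelMoment σ 1 y)
  let H2 : ℝ → ℝ → ℂ := fun σ y => e σ y * (σ * Complex.I *
    (σ * Complex.I * hankelMoment σ 0 y + hankelMoment σ 1 y) +
      (σ * Complex.I * hankelMoment σ 1 y + hankelMoment σ 2 y))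
  have he : ∀ σ y : ℝ, HasDerivAt (e σ) (e σ y * (σ * Complex.I)) y := fun σ y => by
    have := ((hasDerivAt_id y).ofReal_comp.const_mul (σ * Complex.I)).cexp
    exact this.congr_deriv (by simp [e])
  have hH0 : ∀ σ : ℝ, ∀ y > 0, HasDerivAt (H0 σ) (H1 σ y) y := fun σ y hy =>
    ((he σ y).mul (hasDerivAt_hankelMoment σ 0 hy)).congr_deriv (by simp only [H1]; ring)
  have hH1 : ∀ σ : ℝ, ∀ y > 0, HasDerivAt (H1 σ) (H2 σ y) y := fun σ y hy =>
    ((he σ y).mul (((hasDerivAt_hankelMoment σ 0 hy).const_mul (σ * Complex.I)).add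
      (hasDerivAt_hankelMoment σ 1 hy))).congr_deriv (by simp only [H2, Pi.add_apply]; ring)
  have hode : ∀ σ : ℝ, σ ^ 2 = 1 → ∀ y : ℝ, 0 < y →
      y * H2 σ y + H1 σ y + y * H0 σ y = 0 := by
    intro σ hσ y hy
    have hσI : (σ * Complex.I) ^ 2 = -1 := by
      rw [mul_pow, Complex.I_sq, show (σ : ℂ) ^ 2 = 1 by exact_mod_cast hσ, one_mul]
    simp only [H0, H1, H2]
    linear_combination e σ y * bessel_equation_hankelMoment hσ hy +
      y * e σ y * hankelMoment σ 0 y * hσI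
  have hwronskian : ∀ {f g f' g' f'' g'' : ℝ → ℂ}, (∀ y > 0, HasDerivAt f (f' y) y) →
      (∀ y > 0, HasDerivAt f' (f'' y) y) → (∀ y > 0, HasDerivAt g (g' y) y) →
      (∀ y > 0, HasDerivAt g' (g'' y) y) →
      (∀ y : ℝ, 0 < y → y * f'' y + f' y + y * f y = 0) →
      (∀ y : ℝ, 0 < y → y * g'' y + g' y + y * g y = 0) →
      ∀ y : ℝ, 0 < y → y * (f y * g' y - f' y * g y) = f 1 * g' 1 - f' 1 * g 1 := by
    intro f g f' g' f'' g'' hf hf' hg hg' hfo hgo y hy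
    have hd : ∀ y : ℝ, 0 < y →
        HasDerivAt (fun y : ℝ => (y : ℂ) * (f y * g' y - f' y * g y)) 0 y := fun y hy => by
      refine ((hasDerivAt_id y).ofReal_comp.mul
        (((hf y hy).mul (hg' y hy)).sub ((hf' y hy).mul (hg y hy)))).congr_deriv ?_
      simp only [id, Pi.sub_apply, Pi.mul_apply]
      push_cast
      linear_combination f y * hgo y hy - g y * hfo y hy
    have := isOpen_Ioi.is_const_of_deriv_eq_zero (𝕜 := ℝ) isPreconnected_Ioi
      (fun y hy => (hd y hy).differentiableAt.differentiableWithinAt)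
      (fun y hy => (hd y hy).deriv) (mem_Ioi.mpr hy) (mem_Ioi.mpr one_pos)
    simpa using this
  have hw := hwronskian (hH0 1) (hH1 1) (hH0 (-1)) (hH1 (-1)) (hode 1 (by norm_num))
    (hode (-1) (by norm_num))
  have hJp := hwronskian (fun y _ => hasDerivAt_J0Moment 0 y) (fun y _ => hasDerivAt_J0Moment 1 y)
    (hH0 (-1)) (hH1 (-1)) (fun y _ => bessel_equation_J0Moment y) (hode (-1) (by norm_num))
  have hJm := hwronskian (hH0 1) (hH1 1) (fun y _ => hasDerivAt_J0Moment 0 y)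
    (fun y _ => hasDerivAt_J0Moment 1 y) (hode 1 (by norm_num))
    (fun y _ => bessel_equation_J0Moment y)
  have hee : e 1 1 * e (-1) 1 = 1 := by
    simp only [e]; rw [← Complex.exp_add]; simp
  have hne : H0 1 1 * H1 (-1) 1 - H1 1 1 * H0 (-1) 1 ≠ 0 := by
    intro h0
    have h1 : 2 * Complex.I * (hankelMoment 1 0 1 * hankelMoment (-1) 0 1) =
        hankelMoment 1 0 1 * hankelMoment (-1) 1 1 -
          hankelMoment 1 1 1 * hankelMoment (-1) 0 1 := by
      simp only [H0, H1] at h0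
      push_cast at h0
      linear_combination -h0 - (2 * Complex.I * (hankelMoment 1 0 1 * hankelMoment (-1) 0 1) -
        hankelMoment 1 0 1 * hankelMoment (-1) 1 1 +
          hankelMoment 1 1 1 * hankelMoment (-1) 0 1) * hee
    have h2 := norm_sub_le (hankelMoment 1 0 1 * hankelMoment (-1) 1 1)
      (hankelMoment 1 1 1 * hankelMoment (-1) 0 1)
    rw [← h1] at h2
    simp only [norm_mul, Complex.norm_I, Complex.norm_ofNat, mul_one] at h2
    have a1 := le_norm_hankelMoment_zero (σ := 1) (by norm_num)
    have a2 := le_norm_hankelMoment_zero (σ := -1) (by norm_num)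
    have b1 := norm_hankelMoment_one_le 1
    have b2 := norm_hankelMoment_one_le (-1)
    have hπ : 0 < √Real.pi := Real.sqrt_pos.mpr Real.pi_pos
    have c1 := mul_le_mul_of_nonneg_left b2 (norm_nonneg (hankelMoment 1 0 1))
    have c2 := mul_le_mul_of_nonneg_right b1 (norm_nonneg (hankelMoment (-1) 0 1))
    have d1 := mul_le_mul_of_nonneg_left a2 (norm_nonneg (hankelMoment 1 0 1))
    have d2 := mul_le_mul_of_nonneg_right a1 (norm_nonneg (hankelMoment (-1) 0 1))
    nlinarith
  set w := H0 1 1 * H1 (-1) 1 - H1 1 1 * H0 (-1) 1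
  refine ⟨(J0Moment 0 1 * H1 (-1) 1 - J0Moment 1 1 * H0 (-1) 1) / w,
    (H0 1 1 * J0Moment 1 1 - H1 1 1 * J0Moment 0 1) / w, fun y hy => ?_⟩
  have key0 : w * J0Moment 0 y = (J0Moment 0 1 * H1 (-1) 1 - J0Moment 1 1 * H0 (-1) 1) * H0 1 y +
      (H0 1 1 * J0Moment 1 1 - H1 1 1 * J0Moment 0 1) * H0 (-1) y := by
    rw [← hw y hy, ← hJp y hy, ← hJm y hy]
    ring
  have key1 : w * J0Moment 1 y = (J0Moment 0 1 * H1 (-1) 1 - J0Moment 1 1 * H0 (-1) 1) * H1 1 y +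
      (H0 1 1 * J0Moment 1 1 - H1 1 1 * J0Moment 0 1) * H1 (-1) y := by
    rw [← hw y hy, ← hJp y hy, ← hJm y hy]
    ring
  have e1 : e 1 y = Complex.exp (Complex.I * y) := by simp [e]
  have e2 : e (-1) y = Complex.exp (-(Complex.I * y)) := by simp [e]
  rw [← e1, ← e2]
  generalize J0Moment 0 1 * H1 (-1) 1 - J0Moment 1 1 * H0 (-1) 1 = P at key0 key1 ⊢
  generalize H0 1 1 * J0Moment 1 1 - H1 1 1 * J0Moment 0 1 = Q at key0 key1 ⊢
  simp only [H0, H1] at key0 key1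
  push_cast at key0 key1
  constructor
  · refine mul_left_cancel₀ hne (key0.trans ?_)
    field_simp
  · refine mul_left_cancel₀ hne (key1.trans ?_)
    field_simp

/-- `iJ₀(y) + J₀'(y) = (i/2π) ∫₀^{2π} e^{i y sinθ}(1 + sinθ) dθ` admits, for
`y ≥ 1`, the improved stationary-phase decomposition
`iJ₀(y) + J₀'(y) = y^{−1/2} e^{+iy} β₊(y) + y^{−3/2} e^{−iy} β₋(y)`, where `β±` satisfy
`|β±^{(n)}(y)| ≲_n y^{−n}` for all `n ≥ 0`, `y ≥ 1`. -/
theorem bessel_J0_combination_decomposition :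
    ∃ βp βm : ℝ → ℂ, ContDiff ℝ (⊤ : ℕ∞) βp ∧ ContDiff ℝ (⊤ : ℕ∞) βm ∧
      (∀ n : ℕ, ∃ C > (0:ℝ), ∀ y : ℝ, 1 ≤ y →
        ‖iteratedDeriv n βp y‖ ≤ C * y ^ (-(n:ℝ)) ∧
        ‖iteratedDeriv n βm y‖ ≤ C * y ^ (-(n:ℝ))) ∧
      ∀ y : ℝ, 1 ≤ y →
        (Complex.I * J0 y + deriv J0 y
            = (Complex.I / ((2 * Real.pi : ℝ) : ℂ)) *
                ∫ θ in (0:ℝ)..(2 * Real.pi),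
                  Complex.exp (Complex.I * (y:ℂ) * (Real.sin θ : ℂ)) * (1 + (Real.sin θ : ℂ)))
        ∧ Complex.I * J0 y + deriv J0 y
            = (↑(y ^ (-(1/2):ℝ)) : ℂ) * Complex.exp (Complex.I * (y:ℂ)) * βp y
              + (↑(y ^ (-(3/2):ℝ)) : ℂ) * Complex.exp (-(Complex.I * (y:ℂ))) * βm y := by
  obtain ⟨p, q, hpq⟩ := exists_J0_eq_hankel
  have hA0 : IsSymbol (-(1 / 2)) (hankelMoment 1 0) := by simpa using isSymbol_hankelMoment 1 0
  have hA1 : IsSymbol (-(1 / 2)) (hankelMoment 1 1) :=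
    (isSymbol_hankelMoment 1 1).mono (by norm_num)
  have hp : IsSymbol 0 fun y => ((y ^ (1 / 2 : ℝ) : ℝ) : ℂ) *
      (p * ((fun y => 2 * Complex.I * hankelMoment 1 0 y) + hankelMoment 1 1) y) := by
    have h0 : IsSymbol (-(1 / 2)) fun y => 2 * Complex.I * hankelMoment 1 0 y := by
      simpa using (isSymbol_const (2 * Complex.I)).mul hA0
    simpa using (isSymbol_rpow (1 / 2)).mul ((isSymbol_const p).mul (h0.add hA1))
  have hm : IsSymbol 0 fun y => ((y ^ (3 / 2 : ℝ) : ℝ) : ℂ) * (q * hankelMoment (-1) 1 y) := by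
    have := (isSymbol_rpow (3 / 2)).mul ((isSymbol_const q).mul (isSymbol_hankelMoment (-1) 1))
    convert this using 1
    norm_num
  obtain ⟨βp, hβp, hbp, hep⟩ := hp.exists_contDiff
  obtain ⟨βm, hβm, hbm, hem⟩ := hm.exists_contDiff
  refine ⟨βp, βm, hβp, hβm, fun n => ?_, fun y hy => ⟨I_mul_J0_add_deriv y, ?_⟩⟩
  · obtain ⟨C, hC, hC'⟩ := hbp n
    obtain ⟨D, -, hD'⟩ := hbm n
    refine ⟨max C D, lt_max_of_lt_left hC, fun y hy => ?_⟩
    have hy0 : 0 < y := zero_lt_one.trans_le hy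
    exact ⟨(hC' y hy).trans (by gcongr; exact le_max_left _ _),
      (hD' y hy).trans (by gcongr; exact le_max_right _ _)⟩
  · have hy0 : 0 < y := zero_lt_one.trans_le hy
    have hcancel : ∀ s : ℝ, ((y ^ (-s) : ℝ) : ℂ) * ((y ^ s : ℝ) : ℂ) = 1 := fun s => by
      rw [← Complex.ofReal_mul, ← Real.rpow_add hy0]; simp
    rw [hep y hy, hem y hy, ← J0Moment_zero, (hasDerivAt_J0Moment 0 y).deriv, (hpq y hy0).1,
      (hpq y hy0).2, Pi.add_apply]
    linear_combination
      -(Complex.exp (Complex.I * y) * p * (2 * Complex.I * hankelMoment 1 0 y +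
        hankelMoment 1 1 y)) * hcancel (1 / 2) -
      (Complex.exp (-(Complex.I * y)) * q * hankelMoment (-1) 1 y) * hcancel (3 / 2)

end
end

section
/- (+)/(−) interaction null-form bound via change of variables: for radially symmetric functions F, G on R^{1+2} (viewed as functions of (t,r), r > 0), one has ∬_{r>0} r^{−1/2} |r^{1/2} F|^{3/2} |r^{1/2} G|^{3/2} dr dt ≲ ‖r^{1/2}F‖_{L²_{t+r} L^∞_{t−r}}^{3/2} ‖r^{1/2}G‖_{L²_{t−r} L^∞_{t+r}}^{3/2}, where the norms on the right are mixed norms in the null coordinates u = t−r, v = t+r. -/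
open MeasureTheory
open scoped ENNReal

noncomputable section

lemma ENNReal.exists_eq_ofReal_pow {M : ℝ≥0∞} (h0 : M ≠ 0) (ht : M ≠ ∞) {n : ℕ} (hn : n ≠ 0) :
    ∃ x : ℝ, 0 < x ∧ M = ENNReal.ofReal (x ^ n) := by
  have hM : 0 < M.toReal := ENNReal.toReal_pos h0 ht
  refine ⟨M.toReal ^ ((n : ℝ)⁻¹), Real.rpow_pos_of_pos hM _, ?_⟩
  rw [Real.rpow_inv_natCast_pow hM.le hn, ENNReal.ofReal_toReal ht]

lemma ENNReal.ofReal_pow_rpow {x : ℝ} (hx : 0 < x) {n m : ℕ} {p : ℝ} (h : n * p = m) :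
    ENNReal.ofReal (x ^ n) ^ p = ENNReal.ofReal (x ^ m) := by
  rw [ENNReal.ofReal_rpow_of_pos (by positivity), ← Real.rpow_natCast, ← Real.rpow_mul hx.le, h,
    Real.rpow_natCast]

lemma lintegral_Ioc_rpow_neg_half {R : ℝ} (hR : 0 < R) :
    ∫⁻ s in Set.Ioc 0 R, ENNReal.ofReal (s ^ (-(1/2) : ℝ)) =
      ENNReal.ofReal (2 * R ^ ((1:ℝ)/2)) := by
  have hi : IntervalIntegrable (fun s : ℝ => s ^ (-(1/2) : ℝ)) volume 0 R :=
    intervalIntegral.intervalIntegrable_rpow' (by norm_num)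
  rw [← ofReal_integral_eq_lintegral_ofReal
    ((intervalIntegrable_iff_integrableOn_Ioc_of_le hR.le).1 hi)
    ((ae_restrict_mem measurableSet_Ioc).mono fun s hs => Real.rpow_nonneg hs.1.le _),
    ← intervalIntegral.integral_of_le hR.le, integral_rpow (Or.inl (by norm_num)),
    show (-(1/2) + 1 : ℝ) = 1/2 by norm_num, Real.zero_rpow (by norm_num)]
  congr 1
  ring

lemma lintegral_Ioi_rpow_neg_half_pow_four {R : ℝ} (hR : 0 < R) :
    ∫⁻ s in Set.Ioi R, ENNReal.ofReal (s ^ (-(1/2) : ℝ)) ^ (4 : ℝ) = ENNReal.ofReal R⁻¹ := by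
  have h : ∫⁻ s in Set.Ioi R, ENNReal.ofReal (s ^ (-(1/2) : ℝ)) ^ (4 : ℝ) =
      ∫⁻ s in Set.Ioi R, ENNReal.ofReal (s ^ (-2 : ℝ)) := by
    refine setLIntegral_congr_fun measurableSet_Ioi fun s hs => ?_
    have hs : 0 < s := hR.trans hs
    rw [ENNReal.ofReal_rpow_of_pos (by positivity), ← Real.rpow_mul hs.le]
    norm_num
  rw [h, ← ofReal_integral_eq_lintegral_ofReal (integrableOn_Ioi_rpow_of_lt (by norm_num) hR)
    ((ae_restrict_mem measurableSet_Ioi).mono fun s hs => Real.rpow_nonneg (hR.trans hs).le _),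
    integral_Ioi_rpow_of_lt (by norm_num) hR]
  norm_num [Real.rpow_neg_one]

/-- Interpolated bound for the half-line kernel `s ^ (-1/2)` against a bounded square-integrable
function. -/
lemma lintegral_Ioi_rpow_neg_half_mul_le {h : ℝ → ℝ≥0∞} (hh : Measurable h) {c : ℝ≥0∞}
    (hc : ∀ s, h s ≤ c) :
    ∫⁻ s in Set.Ioi 0, ENNReal.ofReal (s ^ (-(1/2) : ℝ)) * h s ^ ((3:ℝ)/2) ≤
      3 * (∫⁻ s, h s ^ (2:ℝ)) ^ ((1:ℝ)/2) * c ^ ((1:ℝ)/2) := by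
  have hk : Measurable fun s : ℝ => ENNReal.ofReal (s ^ (-(1/2) : ℝ)) := by fun_prop
  have zero_of_ae (h0 : ∀ᵐ s, h s = 0) :
      ∫⁻ s in Set.Ioi 0, ENNReal.ofReal (s ^ (-(1/2) : ℝ)) * h s ^ ((3:ℝ)/2) = 0 := by
    refine (lintegral_congr_ae ?_).trans lintegral_zero
    filter_upwards [ae_restrict_of_ae h0] with s hs
    rw [hs, ENNReal.zero_rpow_of_pos (by norm_num), mul_zero]
  set N := ∫⁻ s, h s ^ (2:ℝ) with hN
  rcases eq_or_ne N 0 with hN0 | hN0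
  · rw [zero_of_ae]
    · exact zero_le
    · filter_upwards [(lintegral_eq_zero_iff (by fun_prop)).1 hN0] with s hs
      simpa using hs
  rcases eq_or_ne c 0 with hc0 | hc0
  · rw [zero_of_ae]
    · exact zero_le
    · exact .of_forall fun s => le_antisymm (hc0 ▸ hc s) zero_le
  rcases eq_or_ne N ∞ with hNt | hNt
  · rw [hNt, ENNReal.top_rpow_of_pos (by norm_num), ENNReal.mul_top (by norm_num),
      ENNReal.top_mul (by simp [hc0])]
    exact le_top
  rcases eq_or_ne c ∞ with hct | hct
  · rw [hct, ENNReal.top_rpow_of_pos (by norm_num), ENNReal.mul_top (by simp [hN0])]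
    exact le_top
  obtain ⟨y, hy, hNy⟩ := ENNReal.exists_eq_ofReal_pow hN0 hNt (n := 4) (by norm_num)
  obtain ⟨x, hx, hcx⟩ := ENNReal.exists_eq_ofReal_pow hc0 hct (n := 2) (by norm_num)
  have hR : 0 < (y / x) ^ 4 := by positivity
  have near : ∫⁻ s in Set.Ioc 0 ((y / x) ^ 4),
      ENNReal.ofReal (s ^ (-(1/2) : ℝ)) * h s ^ ((3:ℝ)/2) ≤ ENNReal.ofReal (2 * y ^ 2 * x) :=
    calc
      _ ≤ ∫⁻ s in Set.Ioc 0 ((y / x) ^ 4),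
          ENNReal.ofReal (s ^ (-(1/2) : ℝ)) * c ^ ((3:ℝ)/2) := by
        gcongr
        exact hc _
      _ = ENNReal.ofReal (2 * (y / x) ^ 2) * ENNReal.ofReal (x ^ 3) := by
        rw [lintegral_mul_const _ hk, lintegral_Ioc_rpow_neg_half hR, hcx,
          ENNReal.ofReal_pow_rpow hx (m := 3) (by norm_num), ← Real.rpow_natCast _ 4,
          ← Real.rpow_mul (by positivity)]
        norm_num
      _ = _ := by
        rw [← ENNReal.ofReal_mul (by positivity)]
        congr 1
        field_simp
  have far : ∫⁻ s in Set.Ioi ((y / x) ^ 4),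
      ENNReal.ofReal (s ^ (-(1/2) : ℝ)) * h s ^ ((3:ℝ)/2) ≤ ENNReal.ofReal (y ^ 2 * x) :=
    calc
      _ ≤ (∫⁻ s in Set.Ioi ((y / x) ^ 4), ENNReal.ofReal (s ^ (-(1/2) : ℝ)) ^ (4:ℝ)) ^ (1 / (4:ℝ)) *
          (∫⁻ s in Set.Ioi ((y / x) ^ 4), (h s ^ ((3:ℝ)/2)) ^ ((4:ℝ)/3)) ^ (1 / ((4:ℝ)/3)) :=
        ENNReal.lintegral_mul_le_Lp_mul_Lq _ (Real.holderConjugate_iff.2 (by norm_num))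
          hk.aemeasurable (by fun_prop)
      _ ≤ ENNReal.ofReal ((x / y) ^ 4) ^ (1 / (4:ℝ)) * N ^ (1 / ((4:ℝ)/3)) := by
        rw [lintegral_Ioi_rpow_neg_half_pow_four hR, ← inv_pow, inv_div, hN]
        gcongr ENNReal.ofReal ((x / y) ^ 4) ^ (1 / (4:ℝ)) * ?_ ^ _
        refine (setLIntegral_le_lintegral _ _).trans_eq (lintegral_congr fun s => ?_)
        rw [← ENNReal.rpow_mul]
        norm_num
      _ = _ := by
        rw [hNy, ENNReal.ofReal_pow_rpow (by positivity) (m := 1) (by norm_num),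
          ENNReal.ofReal_pow_rpow hy (m := 3) (by norm_num), ← ENNReal.ofReal_mul (by positivity)]
        congr 1
        field_simp
  rw [← Set.Ioc_union_Ioi_eq_Ioi hR.le]
  refine (lintegral_union_le _ _ _).trans ((add_le_add near far).trans_eq ?_)
  rw [hNy, hcx, ENNReal.ofReal_pow_rpow hy (m := 2) (by norm_num),
    ENNReal.ofReal_pow_rpow hx (m := 1) (by norm_num), ← ENNReal.ofReal_add (by positivity)
    (by positivity), show (3 : ℝ≥0∞) = ENNReal.ofReal 3 by simp, ← ENNReal.ofReal_mul (by positivity),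
    ← ENNReal.ofReal_mul (by positivity)]
  congr 1
  ring

/-- The one-sided fractional integration kernel of order `1/2` on the line. -/
def halfKernel : ℝ → ℝ≥0∞ :=
  (Set.Ioi 0).indicator fun s => ENNReal.ofReal (s ^ (-(1/2) : ℝ))

@[fun_prop]
lemma measurable_halfKernel : Measurable halfKernel :=
  Measurable.indicator (by fun_prop) measurableSet_Ioi

lemma lintegral_halfKernel_mul_le {h : ℝ → ℝ≥0∞} (hh : Measurable h) {c : ℝ≥0∞}
    (hc : ∀ s, h s ≤ c) :
    ∫⁻ s, halfKernel s * h s ^ ((3:ℝ)/2) ≤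
      3 * (∫⁻ s, h s ^ (2:ℝ)) ^ ((1:ℝ)/2) * c ^ ((1:ℝ)/2) := by
  refine Eq.trans_le ?_ (lintegral_Ioi_rpow_neg_half_mul_le hh hc)
  rw [← lintegral_indicator measurableSet_Ioi]
  refine lintegral_congr fun s => ?_
  by_cases hs : s ∈ Set.Ioi (0:ℝ) <;> simp only [halfKernel, Set.indicator, hs, if_true, if_false,
    zero_mul]

lemma lintegral_ite_le_rpow_two (g : ℝ → ℝ≥0∞) (c : ℝ≥0∞) :
    ∫⁻ s, (if g s ≤ c then g s else 0) ^ (2:ℝ) ≤ ∫⁻ s, g s ^ (2:ℝ) := by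
  gcongr with s
  split_ifs <;> simp

lemma lintegral_halfKernel_sub_left_mul_le {g : ℝ → ℝ≥0∞} (hg : Measurable g) (c : ℝ≥0∞) (v : ℝ) :
    ∫⁻ u, halfKernel (v - u) * (if g u ≤ c then g u else 0) ^ ((3:ℝ)/2) ≤
      3 * (∫⁻ u, g u ^ (2:ℝ)) ^ ((1:ℝ)/2) * c ^ ((1:ℝ)/2) := by
  have hm : Measurable fun u => if g u ≤ c then g u else 0 :=
    Measurable.ite (measurableSet_le hg measurable_const) hg measurable_const
  rw [← lintegral_sub_left_eq_self _ v]
  simp only [sub_sub_cancel]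
  refine (lintegral_halfKernel_mul_le (h := fun s => if g (v - s) ≤ c then g (v - s) else 0)
    (hm.comp (measurable_const.sub measurable_id)) (c := c) fun s => ?_).trans ?_
  · split_ifs <;> simp [*]
  · gcongr 3 * ?_ ^ _ * _
    exact (lintegral_sub_left_eq_self (fun u => (if g u ≤ c then g u else 0) ^ (2:ℝ)) v).trans_le
      (lintegral_ite_le_rpow_two g c)

lemma lintegral_halfKernel_sub_right_mul_le {f : ℝ → ℝ≥0∞} (hf : Measurable f) (c : ℝ≥0∞)
    (u : ℝ) :
    ∫⁻ v, halfKernel (v - u) * (if f v ≤ c then f v else 0) ^ ((3:ℝ)/2) ≤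
      3 * (∫⁻ v, f v ^ (2:ℝ)) ^ ((1:ℝ)/2) * c ^ ((1:ℝ)/2) := by
  have hm : Measurable fun v => if f v ≤ c then f v else 0 :=
    Measurable.ite (measurableSet_le hf measurable_const) hf measurable_const
  rw [← lintegral_add_right_eq_self _ u]
  simp only [add_sub_cancel_right]
  refine (lintegral_halfKernel_mul_le (h := fun s => if f (s + u) ≤ c then f (s + u) else 0)
    (hm.comp (measurable_id.add_const u)) (c := c) fun s => ?_).trans ?_
  · split_ifs <;> simp [*]
  · gcongr 3 * ?_ ^ _ * _
    exact (lintegral_add_right_eq_self (fun v => (if f v ≤ c then f v else 0) ^ (2:ℝ)) u).trans_le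
      (lintegral_ite_le_rpow_two f c)

/-- If `J` is controlled by the inner truncated fractional integral, integrate in the outer
variable. -/
lemma lintegral_mul_le_of_le_mul_rpow_half {f J : ℝ → ℝ≥0∞} (hf : Measurable f) {A s : ℝ≥0∞}
    (hJ : ∀ v, J v ≤ A * (s * f v) ^ ((1:ℝ)/2)) :
    ∫⁻ v, f v ^ ((3:ℝ)/2) * J v ≤ A * s ^ ((1:ℝ)/2) * ∫⁻ v, f v ^ (2:ℝ) := by
  rw [← lintegral_const_mul _ (by fun_prop)]
  refine lintegral_mono fun v => ?_
  calc
    _ ≤ f v ^ ((3:ℝ)/2) * (A * (s * f v) ^ ((1:ℝ)/2)) := by gcongr; exact hJ v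
    _ = A * s ^ ((1:ℝ)/2) * (f v ^ ((3:ℝ)/2) * f v ^ ((1:ℝ)/2)) := by
      rw [ENNReal.mul_rpow_of_nonneg _ _ (by norm_num)]
      ring
    _ = _ := by
      rw [← ENNReal.rpow_add_of_nonneg _ _ (by norm_num) (by norm_num)]
      norm_num

/-- The Hardy–Littlewood–Sobolev inequality on the line with kernel `(v - u) ^ (-1/2)`, `u < v`. -/
theorem lintegral_lintegral_halfKernel_le {f g : ℝ → ℝ≥0∞} (hf : Measurable f)
    (hg : Measurable g) :
    ∫⁻ v, ∫⁻ u, halfKernel (v - u) * f v ^ ((3:ℝ)/2) * g u ^ ((3:ℝ)/2) ≤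
      6 * (∫⁻ v, f v ^ (2:ℝ)) ^ ((3:ℝ)/4) * (∫⁻ u, g u ^ (2:ℝ)) ^ ((3:ℝ)/4) := by
  have hfm : Measurable fun p : ℝ × ℝ => f p.1 := hf.comp measurable_fst
  have hgm : Measurable fun p : ℝ × ℝ => g p.2 := hg.comp measurable_snd
  set M := ∫⁻ v, f v ^ (2:ℝ)
  set N := ∫⁻ u, g u ^ (2:ℝ)
  rcases eq_or_ne M 0 with hM0 | hM0
  · refine Eq.trans_le ((lintegral_congr_ae ?_).trans lintegral_zero) zero_le
    filter_upwards [(lintegral_eq_zero_iff (by fun_prop)).1 hM0] with v hv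
    have hv : f v = 0 := by simpa using hv
    simp [hv]
  rcases eq_or_ne N 0 with hN0 | hN0
  · refine Eq.trans_le ((lintegral_congr fun v => ?_).trans lintegral_zero) zero_le
    refine (lintegral_congr_ae ?_).trans lintegral_zero
    filter_upwards [(lintegral_eq_zero_iff (by fun_prop)).1 hN0] with u hu
    have hu : g u = 0 := by simpa using hu
    simp [hu]
  rcases eq_or_ne M ∞ with hMt | hMt
  · rw [hMt, ENNReal.top_rpow_of_pos (by norm_num), ENNReal.mul_top (by norm_num),
      ENNReal.top_mul (ENNReal.rpow_pos_of_nonneg (pos_iff_ne_zero.2 hN0) (by norm_num)).ne']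
    exact le_top
  rcases eq_or_ne N ∞ with hNt | hNt
  · rw [hNt, ENNReal.top_rpow_of_pos (by norm_num), ENNReal.mul_top (mul_ne_zero (by norm_num)
      (ENNReal.rpow_pos_of_nonneg (pos_iff_ne_zero.2 hM0) (by norm_num)).ne')]
    exact le_top
  obtain ⟨x, hx, hMx⟩ := ENNReal.exists_eq_ofReal_pow hM0 hMt (n := 4) (by norm_num)
  obtain ⟨y, hy, hNy⟩ := ENNReal.exists_eq_ofReal_pow hN0 hNt (n := 4) (by norm_num)
  set s := ENNReal.ofReal ((y / x) ^ 2) with hs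
  set s' := ENNReal.ofReal ((x / y) ^ 2) with hs'
  have hss : s' * s = 1 := by
    rw [hs, hs', ← ENNReal.ofReal_mul (by positivity), ← ENNReal.ofReal_one]
    congr 1
    field_simp
  have hm₁ : Measurable fun p : ℝ × ℝ => if g p.2 ≤ s * f p.1 then g p.2 else 0 :=
    Measurable.ite (measurableSet_le hgm (hfm.const_mul s)) hgm measurable_const
  have hm₂ : Measurable fun p : ℝ × ℝ => if f p.1 ≤ s' * g p.2 then f p.1 else 0 :=
    Measurable.ite (measurableSet_le hfm (hgm.const_mul s')) hfm measurable_const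
  have hP₁ : Measurable fun p : ℝ × ℝ => f p.1 ^ ((3:ℝ)/2) *
      (halfKernel (p.1 - p.2) * (if g p.2 ≤ s * f p.1 then g p.2 else 0) ^ ((3:ℝ)/2)) := by
    fun_prop
  have hP₂ : Measurable fun p : ℝ × ℝ => g p.2 ^ ((3:ℝ)/2) *
      (halfKernel (p.1 - p.2) * (if f p.1 ≤ s' * g p.2 then f p.1 else 0) ^ ((3:ℝ)/2)) := by
    fun_prop
  have split (v u : ℝ) : halfKernel (v - u) * f v ^ ((3:ℝ)/2) * g u ^ ((3:ℝ)/2) ≤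
      f v ^ ((3:ℝ)/2) *
        (halfKernel (v - u) * (if g u ≤ s * f v then g u else 0) ^ ((3:ℝ)/2)) +
      g u ^ ((3:ℝ)/2) *
        (halfKernel (v - u) * (if f v ≤ s' * g u then f v else 0) ^ ((3:ℝ)/2)) := by
    by_cases h : g u ≤ s * f v
    · refine le_add_right (le_of_eq ?_)
      rw [if_pos h]
      ring
    · have h' : f v ≤ s' * g u := by
        calc f v = s' * (s * f v) := by rw [← mul_assoc, hss, one_mul]
          _ ≤ _ := by gcongr; exact (not_le.1 h).le
      refine le_add_left (le_of_eq ?_)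
      rw [if_pos h']
      ring
  have low : ∫⁻ v, ∫⁻ u, f v ^ ((3:ℝ)/2) *
      (halfKernel (v - u) * (if g u ≤ s * f v then g u else 0) ^ ((3:ℝ)/2)) ≤
      3 * N ^ ((1:ℝ)/2) * s ^ ((1:ℝ)/2) * M := by
    have h (v : ℝ) : Measurable fun u => halfKernel (v - u) *
        (if g u ≤ s * f v then g u else 0) ^ ((3:ℝ)/2) :=
      (by fun_prop : Measurable fun p : ℝ × ℝ => halfKernel (p.1 - p.2) *
        (if g p.2 ≤ s * f p.1 then g p.2 else 0) ^ ((3:ℝ)/2)).comp measurable_prodMk_left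
    simp_rw [lintegral_const_mul _ (h _)]
    exact lintegral_mul_le_of_le_mul_rpow_half hf fun v =>
      lintegral_halfKernel_sub_left_mul_le hg _ v
  have high : ∫⁻ v, ∫⁻ u, g u ^ ((3:ℝ)/2) *
      (halfKernel (v - u) * (if f v ≤ s' * g u then f v else 0) ^ ((3:ℝ)/2)) ≤
      3 * M ^ ((1:ℝ)/2) * s' ^ ((1:ℝ)/2) * N := by
    have h (u : ℝ) : Measurable fun v => halfKernel (v - u) *
        (if f v ≤ s' * g u then f v else 0) ^ ((3:ℝ)/2) :=
      (by fun_prop : Measurable fun p : ℝ × ℝ => halfKernel (p.1 - p.2) *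
        (if f p.1 ≤ s' * g p.2 then f p.1 else 0) ^ ((3:ℝ)/2)).comp measurable_prodMk_right
    rw [lintegral_lintegral_swap hP₂.aemeasurable]
    simp_rw [lintegral_const_mul _ (h _)]
    exact lintegral_mul_le_of_le_mul_rpow_half hg fun u =>
      lintegral_halfKernel_sub_right_mul_le hf _ u
  calc
    _ ≤ ∫⁻ v, ((∫⁻ u, f v ^ ((3:ℝ)/2) *
          (halfKernel (v - u) * (if g u ≤ s * f v then g u else 0) ^ ((3:ℝ)/2))) +
        ∫⁻ u, g u ^ ((3:ℝ)/2) *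
          (halfKernel (v - u) * (if f v ≤ s' * g u then f v else 0) ^ ((3:ℝ)/2))) := by
      refine lintegral_mono fun v => ?_
      exact (lintegral_mono (split v)).trans_eq
        (lintegral_add_left (hP₁.comp measurable_prodMk_left) _)
    _ ≤ 3 * N ^ ((1:ℝ)/2) * s ^ ((1:ℝ)/2) * M + 3 * M ^ ((1:ℝ)/2) * s' ^ ((1:ℝ)/2) * N := by
      rw [lintegral_add_left hP₁.lintegral_prod_right']
      exact add_le_add low high
    _ = _ := by
      rw [hMx, hNy, hs, hs', ENNReal.ofReal_pow_rpow hy (m := 2) (by norm_num),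
        ENNReal.ofReal_pow_rpow hx (m := 2) (by norm_num),
        ENNReal.ofReal_pow_rpow hy (m := 3) (by norm_num),
        ENNReal.ofReal_pow_rpow hx (m := 3) (by norm_num),
        ENNReal.ofReal_pow_rpow (div_pos hy hx) (m := 1) (by norm_num),
        ENNReal.ofReal_pow_rpow (div_pos hx hy) (m := 1) (by norm_num),
        show (3 : ℝ≥0∞) = ENNReal.ofReal 3 by simp, show (6 : ℝ≥0∞) = ENNReal.ofReal 6 by simp]
      simp only [← ENNReal.ofReal_mul (by positivity : (0:ℝ) ≤ 3),
        ← ENNReal.ofReal_mul (by positivity : (0:ℝ) ≤ 6)]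
      rw [← ENNReal.ofReal_mul (by positivity), ← ENNReal.ofReal_mul (by positivity),
        ← ENNReal.ofReal_mul (by positivity), ← ENNReal.ofReal_mul (by positivity),
        ← ENNReal.ofReal_mul (by positivity), ← ENNReal.ofReal_add (by positivity) (by positivity)]
      congr 1
      field_simp
      norm_num

lemma exists_measurable_le_iSup_ae_le {A : ℝ × ℝ → ℝ≥0∞} (hA : Measurable A) :
    ∃ f : ℝ → ℝ≥0∞, Measurable f ∧ (∀ x, f x ≤ ⨆ y, A (x, y)) ∧ ∀ x, ∀ᵐ y, A (x, y) ≤ f x := by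
  refine ⟨fun x => essSup (fun y => A (x, y)) volume, measurable_of_Ioi fun c => ?_, fun x => ?_,
    fun x => ENNReal.ae_le_essSup _⟩
  · have h : (fun x => essSup (fun y => A (x, y)) volume) ⁻¹' Set.Ioi c =
        {x | volume (Prod.mk x ⁻¹' {p | c < A p}) = 0}ᶜ := by
      ext x
      rw [Set.mem_preimage, Set.mem_Ioi, Set.mem_compl_iff, Set.mem_ofPred_eq, ← not_le, not_iff_not]
      constructor
      · intro h
        refine measure_mono_null (fun y hy => ?_) (ae_iff.1 (ENNReal.ae_le_essSup fun y => A (x, y)))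
        exact not_le.2 (h.trans_lt hy)
      · intro h
        refine essSup_le_of_ae_le c (ae_iff.2 ?_)
        simpa using h
    rw [h]
    exact (measurable_measure_prodMk_left (measurableSet_lt measurable_const hA)
      (measurableSet_singleton 0)).compl
  · exact essSup_le_of_ae_le _ (.of_forall fun y => le_iSup (fun y => A (x, y)) y)

/-- Change of variables `u = t - r`, `v = t + r`. -/
lemma lintegral_lintegral_null_coordinates {h : ℝ × ℝ → ℝ≥0∞} (hh : Measurable h) :
    ∫⁻ t, ∫⁻ r, h (t, r) =
      ENNReal.ofReal (1 / 2) * ∫⁻ u, ∫⁻ v, h ((u + v) / 2, (v - u) / 2) := by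
  rw [lintegral_lintegral_swap (f := fun t r => h (t, r)) hh.aemeasurable]
  have h₁ (r : ℝ) : ∫⁻ t, h (t, r) = ∫⁻ u, h (u + r, r) :=
    (lintegral_add_right_eq_self (fun t => h (t, r)) r).symm
  simp_rw [h₁]
  rw [lintegral_lintegral_swap (f := fun r u => h (u + r, r))
    (by fun_prop), ← lintegral_const_mul _ (by fun_prop)]
  refine lintegral_congr fun u => ?_
  have h₂ := Real.smul_map_volume_mul_left (a := 1 / 2) (by norm_num)
  conv_lhs => rw [← h₂]
  rw [lintegral_smul_measure, lintegral_map (by fun_prop) (by fun_prop),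
    ← lintegral_sub_right_eq_self _ u]
  rw [abs_of_pos (by norm_num), smul_eq_mul]
  congr 1
  refine lintegral_congr fun v => ?_
  congr 2 <;> ring

lemma ofReal_half_rpow_neg_half_le {s : ℝ} (hs : 0 < s) :
    ENNReal.ofReal ((s / 2) ^ (-(1/2) : ℝ)) ≤ 2 * halfKernel s := by
  have h2 : (2:ℝ) ^ ((1:ℝ)/2) ≤ 2 := by
    simpa using Real.rpow_le_rpow_of_exponent_le (x := 2) (by norm_num) (by norm_num : (1:ℝ)/2 ≤ 1)
  rw [halfKernel, Set.indicator_of_mem (Set.mem_Ioi.2 hs),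
    show (2 : ℝ≥0∞) = ENNReal.ofReal 2 by simp, ← ENNReal.ofReal_mul (by norm_num)]
  refine ENNReal.ofReal_le_ofReal ?_
  rw [Real.div_rpow hs.le (by norm_num), Real.rpow_neg (x := 2) (by norm_num), div_inv_eq_mul,
    mul_comm]
  gcongr

lemma ENNReal.ofReal_abs_rpow (x : ℝ) {p : ℝ} (hp : 0 ≤ p) :
    ENNReal.ofReal (|x| ^ p) = ‖x‖ₑ ^ p := by
  rw [← ENNReal.ofReal_rpow_of_nonneg (abs_nonneg x) hp, ← Real.enorm_eq_ofReal_abs]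

/-- (+)/(−) interaction null-form bound via change to null coordinates
`u = t−r`, `v = t+r`:
`∬_{r>0} r^{−1/2} |r^{1/2}F|^{3/2} |r^{1/2}G|^{3/2} dr dt
   ≲ ‖r^{1/2}F‖_{L²_{t+r}L^∞_{t−r}}^{3/2} ‖r^{1/2}G‖_{L²_{t−r}L^∞_{t+r}}^{3/2}`. -/
theorem null_coordinates_bilinear_estimate :
    ∃ C > (0:ℝ), ∀ F G : ℝ × ℝ → ℝ, Measurable F → Measurable G →
      (∫⁻ t : ℝ, ∫⁻ r in Set.Ioi (0:ℝ),
          ENNReal.ofReal (r ^ (-(1/2) : ℝ)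
            * |Real.sqrt r * F (t, r)| ^ ((3:ℝ)/2)
            * |Real.sqrt r * G (t, r)| ^ ((3:ℝ)/2)))
        ≤ ENNReal.ofReal C *
            ((∫⁻ v : ℝ, (⨆ (u : ℝ) (_ : u < v),
                (‖Real.sqrt ((v - u)/2) * F ((u + v)/2, (v - u)/2)‖₊ : ℝ≥0∞)) ^ (2:ℝ))
              ^ ((1:ℝ)/2)) ^ ((3:ℝ)/2) *
            ((∫⁻ u : ℝ, (⨆ (v : ℝ) (_ : u < v),
                (‖Real.sqrt ((v - u)/2) * G ((u + v)/2, (v - u)/2)‖₊ : ℝ≥0∞)) ^ (2:ℝ))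
              ^ ((1:ℝ)/2)) ^ ((3:ℝ)/2) := by
  refine ⟨6, by norm_num, fun F G hF hG => ?_⟩
  have hA : Measurable fun p : ℝ × ℝ => if p.2 < p.1 then
      ‖√((p.1 - p.2) / 2) * F ((p.2 + p.1) / 2, (p.1 - p.2) / 2)‖ₑ else 0 :=
    Measurable.ite (measurableSet_lt measurable_snd measurable_fst) (by fun_prop) measurable_const
  have hB : Measurable fun p : ℝ × ℝ => if p.1 < p.2 then
      ‖√((p.2 - p.1) / 2) * G ((p.1 + p.2) / 2, (p.2 - p.1) / 2)‖ₑ else 0 :=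
    Measurable.ite (measurableSet_lt measurable_fst measurable_snd) (by fun_prop) measurable_const
  have hH : Measurable fun p : ℝ × ℝ => if 0 < p.2 then
      ENNReal.ofReal (p.2 ^ (-(1/2) : ℝ) * |√p.2 * F p| ^ ((3:ℝ)/2) * |√p.2 * G p| ^ ((3:ℝ)/2))
      else 0 :=
    Measurable.ite (measurableSet_lt measurable_const measurable_snd) (by fun_prop) measurable_const
  obtain ⟨f, hf, hf_le, hAf⟩ := exists_measurable_le_iSup_ae_le hA
  obtain ⟨g, hg, hg_le, hBg⟩ := exists_measurable_le_iSup_ae_le hB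
  have hgm : Measurable fun p : ℝ × ℝ => g p.1 := hg.comp measurable_fst
  set A : ℝ × ℝ → ℝ≥0∞ := fun p => if p.2 < p.1 then
      ‖√((p.1 - p.2) / 2) * F ((p.2 + p.1) / 2, (p.1 - p.2) / 2)‖ₑ else 0 with hA_def
  set B : ℝ × ℝ → ℝ≥0∞ := fun p => if p.1 < p.2 then
      ‖√((p.2 - p.1) / 2) * G ((p.1 + p.2) / 2, (p.2 - p.1) / 2)‖ₑ else 0 with hB_def
  have hf_le' (v : ℝ) : f v ≤ ⨆ (u : ℝ) (_ : u < v),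
      (‖√((v - u) / 2) * F ((u + v) / 2, (v - u) / 2)‖₊ : ℝ≥0∞) := by
    refine (hf_le v).trans (iSup_mono fun u => ?_)
    by_cases h : u < v <;> simp [h, enorm_eq_nnnorm]
  have hg_le' (u : ℝ) : g u ≤ ⨆ (v : ℝ) (_ : u < v),
      (‖√((v - u) / 2) * G ((u + v) / 2, (v - u) / 2)‖₊ : ℝ≥0∞) := by
    refine (hg_le u).trans (iSup_mono fun v => ?_)
    by_cases h : u < v <;> simp [h, enorm_eq_nnnorm]
  have integrand_le (u v : ℝ) : (if 0 < (v - u) / 2 then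
      ENNReal.ofReal (((v - u) / 2) ^ (-(1/2) : ℝ)
        * |√((v - u) / 2) * F ((u + v) / 2, (v - u) / 2)| ^ ((3:ℝ)/2)
        * |√((v - u) / 2) * G ((u + v) / 2, (v - u) / 2)| ^ ((3:ℝ)/2)) else 0) ≤
      2 * (halfKernel (v - u) * A (v, u) ^ ((3:ℝ)/2) * B (u, v) ^ ((3:ℝ)/2)) := by
    split_ifs with h
    · have huv : u < v := by linarith
      simp only [hA_def, hB_def, huv, if_true]
      rw [ENNReal.ofReal_mul (by positivity), ENNReal.ofReal_mul (by positivity),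
        ENNReal.ofReal_abs_rpow _ (by norm_num), ENNReal.ofReal_abs_rpow _ (by norm_num),
        ← mul_assoc, ← mul_assoc]
      gcongr
      exact ofReal_half_rpow_neg_half_le (sub_pos.2 huv)
    · exact zero_le
  calc
    _ = ∫⁻ t, ∫⁻ r, if 0 < r then
          ENNReal.ofReal (r ^ (-(1/2) : ℝ) * |√r * F (t, r)| ^ ((3:ℝ)/2)
            * |√r * G (t, r)| ^ ((3:ℝ)/2)) else 0 := by
      refine lintegral_congr fun t => ?_
      rw [← lintegral_indicator measurableSet_Ioi]
      rfl
    _ ≤ ENNReal.ofReal (1 / 2) * ∫⁻ u, ∫⁻ v,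
          2 * (halfKernel (v - u) * A (v, u) ^ ((3:ℝ)/2) * B (u, v) ^ ((3:ℝ)/2)) := by
      rw [lintegral_lintegral_null_coordinates hH]
      gcongr with u v
      exact integrand_le u v
    _ = ∫⁻ u, ∫⁻ v, halfKernel (v - u) * A (v, u) ^ ((3:ℝ)/2) * B (u, v) ^ ((3:ℝ)/2) := by
      simp_rw [lintegral_const_mul' (2 : ℝ≥0∞) _ (by norm_num)]
      rw [← mul_assoc, show (2 : ℝ≥0∞) = ENNReal.ofReal 2 by simp,
        ← ENNReal.ofReal_mul (by norm_num)]
      norm_num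
    _ ≤ ∫⁻ u, ∫⁻ v, halfKernel (v - u) * A (v, u) ^ ((3:ℝ)/2) * g u ^ ((3:ℝ)/2) := by
      refine lintegral_mono fun u => lintegral_mono_ae ?_
      filter_upwards [hBg u] with v hv
      gcongr
    _ = ∫⁻ v, ∫⁻ u, halfKernel (v - u) * A (v, u) ^ ((3:ℝ)/2) * g u ^ ((3:ℝ)/2) :=
      lintegral_lintegral_swap (by fun_prop)
    _ ≤ ∫⁻ v, ∫⁻ u, halfKernel (v - u) * f v ^ ((3:ℝ)/2) * g u ^ ((3:ℝ)/2) := by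
      refine lintegral_mono fun v => lintegral_mono_ae ?_
      filter_upwards [hAf v] with u hu
      gcongr
    _ ≤ 6 * (∫⁻ v, f v ^ (2:ℝ)) ^ ((3:ℝ)/4) * (∫⁻ u, g u ^ (2:ℝ)) ^ ((3:ℝ)/4) :=
      lintegral_lintegral_halfKernel_le hf hg
    _ ≤ _ := by
      rw [← ENNReal.rpow_mul, ← ENNReal.rpow_mul, show (1:ℝ)/2 * (3/2) = 3/4 by norm_num,
        show ENNReal.ofReal 6 = 6 by simp]
      gcongr 6 * (∫⁻ v, ?_ ^ _) ^ _ * (∫⁻ u, ?_ ^ _) ^ _ with v u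
      · exact hf_le' v
      · exact hg_le' u

end
end
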